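/- arXiv:2212.06700 — 8 statements merged into one kernel-verified Lean document; each statement's English description precedes it below -/
import Mathlib

section
/- Let D = (X, Π, G, H) be a Hessian discretisation with coercivity constant C ≥ 0, let F ∈ L²(Ω), and let ψ_D ∈ X be a solution of the Hessian scheme for F, i.e. ⟨H ψ_D, H w⟩ = ⟨F, Π w⟩ for all w ∈ X. Then ‖H ψ_D‖ ≤ C ‖F‖, ‖G ψ_D‖ ≤ C² ‖F‖ and ‖Π ψ_D‖ ≤ C² ‖F‖. -/
open MeasureTheory
open scoped RealInnerProductSpace

/-- **Stability of Hessian schemes.**  If `D = (X, Pd, Gd, Hd)` is a Hessian discretisation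
with coercivity constant `C ≥ 0`, `F ∈ L²(Ω)` and `ψ ∈ X` solves the Hessian scheme for `F`,
then `‖Hd ψ‖ ≤ C ‖F‖`, `‖Gd ψ‖ ≤ C² ‖F‖` and `‖Pd ψ‖ ≤ C² ‖F‖`. -/
theorem hessian_scheme_stability
    {Ω : Type*} [MeasurableSpace Ω] (μ : Measure Ω) (d : ℕ) (hd : 1 ≤ d)
    {X : Type*} [AddCommGroup X] [Module ℝ X]
    (Pd : X →ₗ[ℝ] Lp ℝ 2 μ)
    (Gd : X →ₗ[ℝ] Lp (EuclideanSpace ℝ (Fin d)) 2 μ)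
    (Hd : X →ₗ[ℝ] Lp (EuclideanSpace ℝ (Fin d × Fin d)) 2 μ)
    (C : ℝ) (hC : 0 ≤ C)
    (hcoerPi : ∀ w : X, ‖Pd w‖ ≤ C * ‖Hd w‖)
    (hcoerG : ∀ w : X, ‖Gd w‖ ≤ C * ‖Hd w‖)
    (F : Lp ℝ 2 μ) (ψ : X)
    (hψ : ∀ w : X, ⟪Hd ψ, Hd w⟫ = ⟪F, Pd w⟫) :
    ‖Hd ψ‖ ≤ C * ‖F‖ ∧ ‖Gd ψ‖ ≤ C ^ 2 * ‖F‖ ∧ ‖Pd ψ‖ ≤ C ^ 2 * ‖F‖ := by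
  have hH : ‖Hd ψ‖ ≤ C * ‖F‖ := by
    have energy : ‖Hd ψ‖ * ‖Hd ψ‖ ≤ C * ‖F‖ * ‖Hd ψ‖ :=
      calc ‖Hd ψ‖ * ‖Hd ψ‖ = ⟪F, Pd ψ⟫ := by
            rw [← hψ ψ, real_inner_self_eq_norm_mul_norm]
        _ ≤ ‖F‖ * ‖Pd ψ‖ := real_inner_le_norm _ _
        _ ≤ ‖F‖ * (C * ‖Hd ψ‖) := by gcongr; exact hcoerPi ψ
        _ = C * ‖F‖ * ‖Hd ψ‖ := by ring
    rcases (norm_nonneg (Hd ψ)).eq_or_lt with h0 | hpos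
    · rw [← h0]
      positivity
    · exact le_of_mul_le_mul_right energy hpos
  have hCH : C * ‖Hd ψ‖ ≤ C ^ 2 * ‖F‖ :=
    (mul_le_mul_of_nonneg_left hH hC).trans_eq (by ring)
  exact ⟨hH, (hcoerG ψ).trans hCH, (hcoerPi ψ).trans hCH⟩
end

section
/- Let D = (X, Π, G, H) be a Hessian discretisation, F ∈ L²(Ω), and let ψ_D ∈ X solve the Hessian scheme for F. Let ζ ∈ 𝕊 and W ≥ 0 satisfy the limit-conformity defect bound |⟨F, Π w⟩ − ⟨ζ, H w⟩| ≤ W ‖H w‖ for all w ∈ X. Then for every v ∈ X one has ‖H ψ_D − H v‖ ≤ W + ‖H v − ζ‖. -/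
open MeasureTheory
open scoped RealInnerProductSpace

/-- If `ψ_D` solves the Hessian scheme for `F` and `(ζ, W)` bounds the limit-conformity
defect, then for every `v ∈ X`, `‖Hd ψ_D − Hd v‖ ≤ W + ‖Hd v − ζ‖`. -/
theorem hessian_scheme_abstract_energy_estimate
    {Ω : Type*} [MeasurableSpace Ω] (μ : Measure Ω) (d : ℕ) (hd : 1 ≤ d)
    {X : Type*} [AddCommGroup X] [Module ℝ X]
    (Pd : X →ₗ[ℝ] Lp ℝ 2 μ)
    (Gd : X →ₗ[ℝ] Lp (EuclideanSpace ℝ (Fin d)) 2 μ)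
    (Hd : X →ₗ[ℝ] Lp (EuclideanSpace ℝ (Fin d × Fin d)) 2 μ)
    (F : Lp ℝ 2 μ) (ψ : X)
    (hψ : ∀ w : X, ⟪Hd ψ, Hd w⟫ = ⟪F, Pd w⟫)
    (ζ : Lp (EuclideanSpace ℝ (Fin d × Fin d)) 2 μ)
    (W : ℝ) (hW : 0 ≤ W)
    (hlc : ∀ w : X, |⟪F, Pd w⟫ - ⟪ζ, Hd w⟫| ≤ W * ‖Hd w‖) :
    ∀ v : X, ‖Hd ψ - Hd v‖ ≤ W + ‖Hd v - ζ‖ := by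
  intro v
  have hw := (abs_le.mp (hlc (ψ - v))).2
  rw [← hψ, map_sub] at hw
  set e := Hd ψ - Hd v with he
  have hcs : ⟪ζ - Hd v, e⟫ ≤ ‖Hd v - ζ‖ * ‖e‖ := by
    rw [norm_sub_rev]
    exact real_inner_le_norm _ _
  have hsq : ⟪Hd ψ, e⟫ - ⟪Hd v, e⟫ = ‖e‖ * ‖e‖ := by
    rw [← inner_sub_left, ← he, real_inner_self_eq_norm_mul_norm]
  rw [inner_sub_left] at hcs
  rcases (norm_nonneg e).eq_or_lt with h0 | hpos
  · rw [← h0]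
    positivity
  · refine le_of_mul_le_mul_right ?_ hpos
    linarith
end

section
/- Let D = (X, Π, G, H) be a Hessian discretisation, F ∈ L²(Ω), and let ψ_D ∈ X solve the Hessian scheme for F. Let ψ ∈ L²(Ω), g ∈ L²(Ω)^d and ζ ∈ 𝕊 be exact data, let W ≥ 0 satisfy |⟨F, Π w⟩ − ⟨ζ, H w⟩| ≤ W ‖H w‖ for all w ∈ X, and let S ≥ 0 and v₀ ∈ X satisfy ‖Π v₀ − ψ‖ + ‖G v₀ − g‖ + ‖H v₀ − ζ‖ ≤ S. Then ‖H ψ_D − ζ‖ ≤ W + 2S. -/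
open MeasureTheory
open scoped RealInnerProductSpace

/-- If `a - z` pairs with `a - h` to at most `W * ‖a - h‖`, then `a` is within
`W + 2 * ‖h - z‖` of `z`. -/
theorem norm_sub_le_of_inner_sub_le {E : Type*} [NormedAddCommGroup E] [InnerProductSpace ℝ E]
    {a h z : E} {W : ℝ} (hW : 0 ≤ W) (hinner : ⟪a - z, a - h⟫ ≤ W * ‖a - h‖) :
    ‖a - z‖ ≤ W + 2 * ‖h - z‖ := by
  have hsq : ‖a - h‖ * ‖a - h‖ ≤ (W + ‖h - z‖) * ‖a - h‖ := by
    have hsplit : ⟪a - h, a - h⟫ = ⟪a - z, a - h⟫ - ⟪h - z, a - h⟫ := by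
      rw [← inner_sub_left, sub_sub_sub_cancel_right]
    have hcs := neg_le_of_abs_le (abs_real_inner_le_norm (h - z) (a - h))
    rw [real_inner_self_eq_norm_mul_norm] at hsplit
    linarith
  have hah : ‖a - h‖ ≤ W + ‖h - z‖ := by
    rcases (norm_nonneg (a - h)).eq_or_lt with h0 | hpos
    · rw [← h0]; positivity
    · exact le_of_mul_le_mul_right hsq hpos
  linarith [norm_sub_le_norm_sub_add_norm_sub a h z]

/-- **Energy error estimate for Hessian schemes.**  If `ψ_D` solves the Hessian scheme for
`F`, `W` bounds the limit-conformity defect for the exact Hessian data `ζ`, and `S` bounds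
the interpolation (consistency) error attained at some `v₀ ∈ X`, then
`‖Hd ψ_D − ζ‖ ≤ W + 2S`. -/
theorem hessian_scheme_energy_error_estimate
    {Ω : Type*} [MeasurableSpace Ω] (μ : Measure Ω) (d : ℕ) (hd : 1 ≤ d)
    {X : Type*} [AddCommGroup X] [Module ℝ X]
    (Pd : X →ₗ[ℝ] Lp ℝ 2 μ)
    (Gd : X →ₗ[ℝ] Lp (EuclideanSpace ℝ (Fin d)) 2 μ)
    (Hd : X →ₗ[ℝ] Lp (EuclideanSpace ℝ (Fin d × Fin d)) 2 μ)
    (F : Lp ℝ 2 μ) (ψD : X)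
    (hψD : ∀ w : X, ⟪Hd ψD, Hd w⟫ = ⟪F, Pd w⟫)
    (ψ : Lp ℝ 2 μ) (g : Lp (EuclideanSpace ℝ (Fin d)) 2 μ)
    (ζ : Lp (EuclideanSpace ℝ (Fin d × Fin d)) 2 μ)
    (W : ℝ) (hW : 0 ≤ W)
    (hlc : ∀ w : X, |⟪F, Pd w⟫ - ⟪ζ, Hd w⟫| ≤ W * ‖Hd w‖)
    (S : ℝ) (hS : 0 ≤ S) (v₀ : X)
    (hcons : ‖Pd v₀ - ψ‖ + ‖Gd v₀ - g‖ + ‖Hd v₀ - ζ‖ ≤ S) :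
    ‖Hd ψD - ζ‖ ≤ W + 2 * S := by
  have hinner : ⟪Hd ψD - ζ, Hd ψD - Hd v₀⟫ ≤ W * ‖Hd ψD - Hd v₀‖ := by
    rw [← map_sub, inner_sub_left, hψD]
    exact (le_abs_self _).trans (hlc _)
  linarith [norm_sub_le_of_inner_sub_le hW hinner, norm_nonneg (Pd v₀ - ψ),
    norm_nonneg (Gd v₀ - g)]
end

section
/- Let D = (X, Π, G, H) be a Hessian discretisation with coercivity constant C ≥ 0, let F ∈ L²(Ω), and let ψ_D ∈ X solve the Hessian scheme for F. Let ψ ∈ L²(Ω), g ∈ L²(Ω)^d and ζ ∈ 𝕊 be exact data, let W ≥ 0 satisfy |⟨F, Π w⟩ − ⟨ζ, H w⟩| ≤ W ‖H w‖ for all w ∈ X, and let S ≥ 0 and v₀ ∈ X satisfy ‖Π v₀ − ψ‖ + ‖G v₀ − g‖ + ‖H v₀ − ζ‖ ≤ S. Then ‖Π ψ_D − ψ‖ ≤ C W + (C + 1) S. -/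
open MeasureTheory
open scoped RealInnerProductSpace

/-- If `a` solves a variational problem up to a consistency defect `W` in the direction `a - b`,
then `a` is as close to `b` as `b` is to `z`, up to `W`. -/
theorem norm_sub_le_of_abs_inner_sub_le {E : Type*} [NormedAddCommGroup E]
    [InnerProductSpace ℝ E] {a b z : E} {W : ℝ} (hW : 0 ≤ W)
    (h : |⟪a, a - b⟫ - ⟪z, a - b⟫| ≤ W * ‖a - b‖) :
    ‖a - b‖ ≤ W + ‖b - z‖ := by
  have key : ‖a - b‖ * ‖a - b‖ ≤ (W + ‖b - z‖) * ‖a - b‖ := by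
    have hsplit : ⟪a - b, a - b⟫ = (⟪a, a - b⟫ - ⟪z, a - b⟫) - ⟪b - z, a - b⟫ := by
      rw [inner_sub_left a b (a - b), inner_sub_left b z (a - b)]
      ring
    rw [← real_inner_self_eq_norm_mul_norm, hsplit]
    linarith [le_of_abs_le h, neg_le_of_abs_le (abs_real_inner_le_norm (b - z) (a - b))]
  rcases (norm_nonneg (a - b)).eq_or_lt with h0 | h0
  · rw [← h0]
    positivity
  · exact le_of_mul_le_mul_right key h0

/-- **Error estimate for Hessian schemes** (Theorem 3.6 of the HDM paper), for a Hessian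
discretisation with coercivity constant `C ≥ 0`, limit-conformity defect bound `W` and
consistency bound `S` attained at `v₀`. -/
theorem hessian_scheme_L2_error_estimate
    {Ω : Type*} [MeasurableSpace Ω] (μ : Measure Ω) (d : ℕ) (hd : 1 ≤ d)
    {X : Type*} [AddCommGroup X] [Module ℝ X]
    (Pd : X →ₗ[ℝ] Lp ℝ 2 μ)
    (Gd : X →ₗ[ℝ] Lp (EuclideanSpace ℝ (Fin d)) 2 μ)
    (Hd : X →ₗ[ℝ] Lp (EuclideanSpace ℝ (Fin d × Fin d)) 2 μ)
    (C : ℝ) (hC : 0 ≤ C)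
    (hcoerPi : ∀ w : X, ‖Pd w‖ ≤ C * ‖Hd w‖)
    (hcoerG : ∀ w : X, ‖Gd w‖ ≤ C * ‖Hd w‖)
    (F : Lp ℝ 2 μ) (ψD : X)
    (hψD : ∀ w : X, ⟪Hd ψD, Hd w⟫ = ⟪F, Pd w⟫)
    (ψ : Lp ℝ 2 μ) (g : Lp (EuclideanSpace ℝ (Fin d)) 2 μ)
    (ζ : Lp (EuclideanSpace ℝ (Fin d × Fin d)) 2 μ)
    (W : ℝ) (hW : 0 ≤ W)
    (hlc : ∀ w : X, |⟪F, Pd w⟫ - ⟪ζ, Hd w⟫| ≤ W * ‖Hd w‖)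
    (S : ℝ) (hS : 0 ≤ S) (v₀ : X)
    (hcons : ‖Pd v₀ - ψ‖ + ‖Gd v₀ - g‖ + ‖Hd v₀ - ζ‖ ≤ S) :
    ‖Pd ψD - ψ‖ ≤ C * W + (C + 1) * S := by
  have hH : ‖Hd ψD - Hd v₀‖ ≤ W + ‖Hd v₀ - ζ‖ := by
    refine norm_sub_le_of_abs_inner_sub_le hW ?_
    rw [← map_sub, hψD]
    exact hlc _
  have hP : ‖Pd ψD - Pd v₀‖ ≤ C * (W + ‖Hd v₀ - ζ‖) := by
    have h := hcoerPi (ψD - v₀)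
    rw [map_sub, map_sub] at h
    exact h.trans (mul_le_mul_of_nonneg_left hH hC)
  have hP₀ : ‖Pd v₀ - ψ‖ ≤ S := by
    linarith [norm_nonneg (Gd v₀ - g), norm_nonneg (Hd v₀ - ζ)]
  have hH₀ : ‖Hd v₀ - ζ‖ ≤ S := by
    linarith [norm_nonneg (Gd v₀ - g), norm_nonneg (Pd v₀ - ψ)]
  calc ‖Pd ψD - ψ‖ ≤ ‖Pd ψD - Pd v₀‖ + ‖Pd v₀ - ψ‖ := norm_sub_le_norm_sub_add_norm_sub _ _ _
    _ ≤ C * (W + S) + S := by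
      gcongr
      exact hP.trans (by gcongr)
    _ = C * W + (C + 1) * S := by ring
end

section
/- Let D = (X, Π, G, H) be a Hessian discretisation with coercivity constant C ≥ 0, let F ∈ L²(Ω), and let ψ_D ∈ X solve the Hessian scheme for F. Let ψ ∈ L²(Ω), g ∈ L²(Ω)^d and ζ ∈ 𝕊 be exact data, let W ≥ 0 satisfy |⟨F, Π w⟩ − ⟨ζ, H w⟩| ≤ W ‖H w‖ for all w ∈ X, and let S ≥ 0 and v₀ ∈ X satisfy ‖Π v₀ − ψ‖ + ‖G v₀ − g‖ + ‖H v₀ − ζ‖ ≤ S. Then ‖G ψ_D − g‖ ≤ C W + (C + 1) S. -/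
open MeasureTheory
open scoped RealInnerProductSpace

/-- **Error estimate for Hessian schemes** (Theorem 3.6 of the HDM paper), for a Hessian
discretisation with coercivity constant `C ≥ 0`, limit-conformity defect bound `W` and
consistency bound `S` attained at `v₀`. -/
theorem hessian_scheme_H1_error_estimate
    {Ω : Type*} [MeasurableSpace Ω] (μ : Measure Ω) (d : ℕ) (hd : 1 ≤ d)
    {X : Type*} [AddCommGroup X] [Module ℝ X]
    (Pd : X →ₗ[ℝ] Lp ℝ 2 μ)
    (Gd : X →ₗ[ℝ] Lp (EuclideanSpace ℝ (Fin d)) 2 μ)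
    (Hd : X →ₗ[ℝ] Lp (EuclideanSpace ℝ (Fin d × Fin d)) 2 μ)
    (C : ℝ) (hC : 0 ≤ C)
    (hcoerPi : ∀ w : X, ‖Pd w‖ ≤ C * ‖Hd w‖)
    (hcoerG : ∀ w : X, ‖Gd w‖ ≤ C * ‖Hd w‖)
    (F : Lp ℝ 2 μ) (ψD : X)
    (hψD : ∀ w : X, ⟪Hd ψD, Hd w⟫ = ⟪F, Pd w⟫)
    (ψ : Lp ℝ 2 μ) (g : Lp (EuclideanSpace ℝ (Fin d)) 2 μ)
    (ζ : Lp (EuclideanSpace ℝ (Fin d × Fin d)) 2 μ)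
    (W : ℝ) (hW : 0 ≤ W)
    (hlc : ∀ w : X, |⟪F, Pd w⟫ - ⟪ζ, Hd w⟫| ≤ W * ‖Hd w‖)
    (S : ℝ) (hS : 0 ≤ S) (v₀ : X)
    (hcons : ‖Pd v₀ - ψ‖ + ‖Gd v₀ - g‖ + ‖Hd v₀ - ζ‖ ≤ S) :
    ‖Gd ψD - g‖ ≤ C * W + (C + 1) * S := by
  have hH : ‖Hd (ψD - v₀)‖ ≤ W + ‖Hd v₀ - ζ‖ := by
    have hsq : ‖Hd (ψD - v₀)‖ * ‖Hd (ψD - v₀)‖ ≤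
        (W + ‖Hd v₀ - ζ‖) * ‖Hd (ψD - v₀)‖ := by
      have hsplit : ⟪Hd (ψD - v₀), Hd (ψD - v₀)⟫ =
          (⟪F, Pd (ψD - v₀)⟫ - ⟪ζ, Hd (ψD - v₀)⟫) - ⟪Hd v₀ - ζ, Hd (ψD - v₀)⟫ := by
        rw [← hψD (ψD - v₀), ← inner_sub_left, ← inner_sub_left, sub_sub_sub_cancel_right,
          map_sub]
      have hdefect := (abs_le.mp (hlc (ψD - v₀))).2
      have hinner := (abs_le.mp (abs_real_inner_le_norm (Hd v₀ - ζ) (Hd (ψD - v₀)))).1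
      rw [← real_inner_self_eq_norm_mul_norm, hsplit]
      linarith
    rcases (norm_nonneg (Hd (ψD - v₀))).eq_or_lt with h | h
    · rw [← h]
      positivity
    · exact le_of_mul_le_mul_right hsq h
  have hHS : ‖Hd (ψD - v₀)‖ ≤ W + S := by
    linarith [norm_nonneg (Pd v₀ - ψ), norm_nonneg (Gd v₀ - g)]
  have hGS : ‖Gd v₀ - g‖ ≤ S := by
    linarith [norm_nonneg (Pd v₀ - ψ), norm_nonneg (Hd v₀ - ζ)]
  calc ‖Gd ψD - g‖ = ‖Gd (ψD - v₀) + (Gd v₀ - g)‖ := by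
        rw [map_sub, sub_add_sub_cancel]
    _ ≤ ‖Gd (ψD - v₀)‖ + ‖Gd v₀ - g‖ := norm_add_le _ _
    _ ≤ C * (W + S) + S :=
        add_le_add ((hcoerG _).trans (mul_le_mul_of_nonneg_left hHS hC)) hGS
    _ = C * W + (C + 1) * S := by ring
end

section
/- Let D = (X, Π, G, H) be a Hessian discretisation with coercivity constant C ≥ 1. Let ū, u_h ∈ L²(ω) and let y_D ∈ X satisfy the discrete state equation ⟨H y_D, H w⟩ = ⟨f + 𝒞 u_h, Π w⟩ for all w ∈ X. Let ȳ ∈ L²(Ω), g_y ∈ L²(Ω)^d, ζ_y ∈ 𝕊 be exact state data, let W_y ≥ 0 satisfy |⟨f + 𝒞 ū, Π w⟩ − ⟨ζ_y, H w⟩| ≤ W_y ‖H w‖ for all w ∈ X, and let S_y ≥ 0 and v₀ ∈ X satisfy ‖Π v₀ − ȳ‖ + ‖G v₀ − g_y‖ + ‖H v₀ − ζ_y‖ ≤ S_y. Then each of the quantities ‖Π y_D − ȳ‖, ‖G y_D − g_y‖ and ‖H y_D − ζ_y‖ is at most 2C² ( ‖ū − u_h‖ + W_y + S_y ). -/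
open MeasureTheory
open scoped RealInnerProductSpace

/-- In an abstract Hessian discretisation, the distance in the energy norm between the discrete
solution and any interpolant is controlled by the data perturbation, the conformity defect and the
interpolation error. -/
theorem norm_map_sub_le_of_weak_form {X V W : Type*} [AddCommGroup X] [Module ℝ X]
    [NormedAddCommGroup V] [InnerProductSpace ℝ V] [NormedAddCommGroup W] [InnerProductSpace ℝ W]
    (P : X →ₗ[ℝ] V) (H : X →ₗ[ℝ] W) {C δ : ℝ} (hP : ∀ w, ‖P w‖ ≤ C * ‖H w‖)
    {F F' : V} {y : X} (hy : ∀ w, ⟪H y, H w⟫ = ⟪F', P w⟫) {ζ : W}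
    (hδ : ∀ w, |⟪F, P w⟫ - ⟪ζ, H w⟫| ≤ δ * ‖H w‖) (v : X) (hnonneg : 0 ≤ C * ‖F - F'‖ + δ) :
    ‖H y - H v‖ ≤ C * ‖F - F'‖ + δ + ‖H v - ζ‖ := by
  have hw := hδ (y - v)
  have hPw := hP (y - v)
  have hyw := hy (y - v)
  rw [← map_sub]
  generalize hz : y - v = w at hw hPw hyw ⊢
  have hsplit : ‖H w‖ * ‖H w‖ =
      (⟪F, P w⟫ - ⟪ζ, H w⟫) - ⟪F - F', P w⟫ - ⟪H v - ζ, H w⟫ := by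
    rw [← real_inner_self_eq_norm_mul_norm]
    nth_rewrite 1 [← hz]
    rw [map_sub, inner_sub_left, inner_sub_left, inner_sub_left, hyw]
    ring
  have h₁ := (le_abs_self _).trans hw
  have h₂ := neg_le_of_abs_le (abs_real_inner_le_norm (F - F') (P w))
  have h₃ := neg_le_of_abs_le (abs_real_inner_le_norm (H v - ζ) (H w))
  have h₄ := mul_le_mul_of_nonneg_left hPw (norm_nonneg (F - F'))
  rcases (norm_nonneg (H w)).eq_or_lt with h | h
  · rw [← h]
    positivity
  · refine le_of_mul_le_mul_right ?_ h
    linarith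

/-- **Basic error estimate for the discrete state variable.**  If `y_D` solves the discrete
state equation with discrete control `u_h`, then the errors in the reconstructed function,
gradient and Hessian are bounded by `2C²(‖ū − u_h‖ + W_y + S_y)`. -/
theorem discrete_state_error_estimate
    {Ω : Type*} [MeasurableSpace Ω] (μ : Measure Ω) (d : ℕ) (hd : 1 ≤ d)
    (ω : Set Ω) (hω : MeasurableSet ω)
    {X : Type*} [AddCommGroup X] [Module ℝ X]
    (Pd : X →ₗ[ℝ] Lp ℝ 2 μ)
    (Gd : X →ₗ[ℝ] Lp (EuclideanSpace ℝ (Fin d)) 2 μ)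
    (Hd : X →ₗ[ℝ] Lp (EuclideanSpace ℝ (Fin d × Fin d)) 2 μ)
    (C : ℝ) (hC : 1 ≤ C)
    (hcoerPi : ∀ w : X, ‖Pd w‖ ≤ C * ‖Hd w‖)
    (hcoerG : ∀ w : X, ‖Gd w‖ ≤ C * ‖Hd w‖)
    -- the operator 𝒞 (extension by zero) and its adjoint 𝒞* (restriction)
    (Cop : Lp ℝ 2 (μ.restrict ω) →ₗ[ℝ] Lp ℝ 2 μ)
    (Cs : Lp ℝ 2 μ →ₗ[ℝ] Lp ℝ 2 (μ.restrict ω))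
    (hadj : ∀ (q : Lp ℝ 2 μ) (v : Lp ℝ 2 (μ.restrict ω)), ⟪Cs q, v⟫ = ⟪q, Cop v⟫)
    (hiso : ∀ v : Lp ℝ 2 (μ.restrict ω), ‖Cop v‖ = ‖v‖)
    (α : ℝ) (hα : 0 < α) (f yd : Lp ℝ 2 μ) (ud : Lp ℝ 2 (μ.restrict ω))
    (ubar uh : Lp ℝ 2 (μ.restrict ω)) (yD : X)
    (hyD : ∀ w : X, ⟪Hd yD, Hd w⟫ = ⟪f + Cop uh, Pd w⟫)
    (ybar : Lp ℝ 2 μ) (gy : Lp (EuclideanSpace ℝ (Fin d)) 2 μ)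
    (ζy : Lp (EuclideanSpace ℝ (Fin d × Fin d)) 2 μ)
    (Wy : ℝ) (hWy : 0 ≤ Wy)
    (hlc : ∀ w : X, |⟪f + Cop ubar, Pd w⟫ - ⟪ζy, Hd w⟫| ≤ Wy * ‖Hd w‖)
    (Sy : ℝ) (hSy : 0 ≤ Sy) (v₀ : X)
    (hcons : ‖Pd v₀ - ybar‖ + ‖Gd v₀ - gy‖ + ‖Hd v₀ - ζy‖ ≤ Sy) :
    ‖Pd yD - ybar‖ ≤ 2 * C ^ 2 * (‖ubar - uh‖ + Wy + Sy) ∧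
      ‖Gd yD - gy‖ ≤ 2 * C ^ 2 * (‖ubar - uh‖ + Wy + Sy) ∧
      ‖Hd yD - ζy‖ ≤ 2 * C ^ 2 * (‖ubar - uh‖ + Wy + Sy) := by
  have hF : ‖(f + Cop ubar) - (f + Cop uh)‖ = ‖ubar - uh‖ := by
    rw [add_sub_add_left_eq_sub, ← map_sub, hiso]
  have hu := norm_nonneg (ubar - uh)
  have hH := norm_map_sub_le_of_weak_form Pd Hd hcoerPi hyD hlc v₀ (by positivity)
  rw [hF] at hH
  have hP := hcoerPi (yD - v₀)
  have hG := hcoerG (yD - v₀)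
  simp only [map_sub] at hP hG
  have tP := norm_sub_le_norm_sub_add_norm_sub (Pd yD) (Pd v₀) ybar
  have tG := norm_sub_le_norm_sub_add_norm_sub (Gd yD) (Gd v₀) gy
  have tH := norm_sub_le_norm_sub_add_norm_sub (Hd yD) (Hd v₀) ζy
  have nP := norm_nonneg (Pd v₀ - ybar)
  have nG := norm_nonneg (Gd v₀ - gy)
  have nH := norm_nonneg (Hd v₀ - ζy)
  have hCC : C ≤ C ^ 2 := by nlinarith
  have hmul : C * ‖Hd yD - Hd v₀‖ ≤ C * (C * ‖ubar - uh‖ + Wy + Sy) := by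
    gcongr
    linarith
  have hle : ‖Hd yD - Hd v₀‖ ≤ C * ‖Hd yD - Hd v₀‖ :=
    le_mul_of_one_le_left (norm_nonneg _) hC
  have hbound : C * (C * ‖ubar - uh‖ + Wy + Sy) + Sy ≤
      2 * C ^ 2 * (‖ubar - uh‖ + Wy + Sy) := by
    have hCW := mul_le_mul_of_nonneg_right hCC hWy
    have hCS := mul_le_mul_of_nonneg_right hCC hSy
    have hS := mul_le_mul_of_nonneg_right (hC.trans hCC) hSy
    have hu₂ : 0 ≤ C ^ 2 * ‖ubar - uh‖ := by positivity
    have hW₂ : 0 ≤ C ^ 2 * Wy := by positivity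
    linarith
  refine ⟨?_, ?_, ?_⟩ <;> linarith
end

section
/- Let D = (X, Π, G, H) be a Hessian discretisation with coercivity constant C ≥ 1. Let ū, u_h ∈ L²(ω), let y_D ∈ X satisfy ⟨H y_D, H w⟩ = ⟨f + 𝒞 u_h, Π w⟩ for all w ∈ X, and let p_D ∈ X satisfy the discrete adjoint equation ⟨H w, H p_D⟩ = ⟨Π y_D − y_d, Π w⟩ for all w ∈ X. Let ȳ ∈ L²(Ω), g_y ∈ L²(Ω)^d, ζ_y ∈ 𝕊 and W_y, S_y ≥ 0, v₀ ∈ X satisfy |⟨f + 𝒞 ū, Π w⟩ − ⟨ζ_y, H w⟩| ≤ W_y ‖H w‖ for all w ∈ X and ‖Π v₀ − ȳ‖ + ‖G v₀ − g_y‖ + ‖H v₀ − ζ_y‖ ≤ S_y; and let p̄ ∈ L²(Ω), g_p ∈ L²(Ω)^d, ζ_p ∈ 𝕊 and W_p, S_p ≥ 0, v₁ ∈ X satisfy |⟨ȳ − y_d, Π w⟩ − ⟨ζ_p, H w⟩| ≤ W_p ‖H w‖ for all w ∈ X and ‖Π v₁ − p̄‖ + ‖G v₁ − g_p‖ + ‖H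 v₁ − ζ_p‖ ≤ S_p. Then each of the quantities ‖Π p_D − p̄‖, ‖G p_D − g_p‖ and ‖H p_D − ζ_p‖ is at most 2C⁴ ( ‖ū − u_h‖ + W_y + S_y + W_p + S_p ). -/
open MeasureTheory
open scoped RealInnerProductSpace

/-- **Perturbed Strang-type estimate.**  If `x` solves a discrete problem with source `F'`, while
`ζ` satisfies the equation with source `F` up to a consistency defect `W`, and `(z, g, ζ)` is
interpolated by `v` up to `S`, then the reconstruction errors of `x` are controlled by the
perturbation `F' - F`, `W` and `S`. -/
theorem perturbed_strang_estimate {X U V E : Type*} [AddCommGroup X] [Module ℝ X]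
    [NormedAddCommGroup U] [InnerProductSpace ℝ U] [SeminormedAddCommGroup V] [Module ℝ V]
    [NormedAddCommGroup E] [InnerProductSpace ℝ E]
    (P : X →ₗ[ℝ] U) (G : X →ₗ[ℝ] V) (H : X →ₗ[ℝ] E) {C : ℝ} (hC : 1 ≤ C)
    (hP : ∀ w, ‖P w‖ ≤ C * ‖H w‖) (hG : ∀ w, ‖G w‖ ≤ C * ‖H w‖)
    {F F' z : U} {g : V} {ζ : E} {x v : X} {W S : ℝ} (hW : 0 ≤ W)
    (hx : ∀ w, ⟪H x, H w⟫ = ⟪F', P w⟫)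
    (hdefect : ∀ w, |⟪F, P w⟫ - ⟪ζ, H w⟫| ≤ W * ‖H w‖)
    (hv : ‖P v - z‖ + ‖G v - g‖ + ‖H v - ζ‖ ≤ S) :
    ‖P x - z‖ ≤ C * (C * ‖F' - F‖ + W + S) ∧
      ‖G x - g‖ ≤ C * (C * ‖F' - F‖ + W + S) ∧
      ‖H x - ζ‖ ≤ C * ‖F' - F‖ + W + 2 * S := by
  have hPv := norm_nonneg (P v - z)
  have hGv := norm_nonneg (G v - g)
  have hHv := norm_nonneg (H v - ζ)
  have hF := norm_nonneg (F' - F)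
  have key : ‖H (x - v)‖ ≤ C * ‖F' - F‖ + W + ‖H v - ζ‖ := by
    have hsplit : ‖H (x - v)‖ * ‖H (x - v)‖ =
        ⟪F' - F, P (x - v)⟫ + (⟪F, P (x - v)⟫ - ⟪ζ, H (x - v)⟫)
          - ⟪H v - ζ, H (x - v)⟫ := by
      have hself := real_inner_self_eq_norm_mul_norm (H (x - v))
      have hexpand : ⟪H (x - v), H (x - v)⟫ = ⟪H x, H (x - v)⟫ - ⟪H v, H (x - v)⟫ := by
        rw [← inner_sub_left, ← map_sub]
      rw [← hself, hexpand, hx, inner_sub_left, inner_sub_left]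
      ring
    have h1 : ⟪F' - F, P (x - v)⟫ ≤ ‖F' - F‖ * (C * ‖H (x - v)‖) :=
      (real_inner_le_norm _ _).trans (mul_le_mul_of_nonneg_left (hP _) hF)
    have h2 := (abs_le.mp (hdefect (x - v))).2
    have h3 := (abs_le.mp (abs_real_inner_le_norm (H v - ζ) (H (x - v)))).1
    rcases (norm_nonneg (H (x - v))).eq_or_lt with h0 | h0
    · rw [← h0]
      positivity
    · refine le_of_mul_le_mul_right ?_ h0
      linarith
  have hCkey := mul_le_mul_of_nonneg_left key (zero_le_one.trans hC)
  have hCS := mul_le_mul_of_nonneg_left hv (zero_le_one.trans hC)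
  have hCP := mul_nonneg (zero_le_one.trans hC) hPv
  have hCG := mul_nonneg (zero_le_one.trans hC) hGv
  have hCP' := le_mul_of_one_le_left hPv hC
  have hCG' := le_mul_of_one_le_left hGv hC
  have tP : ‖P x - z‖ ≤ ‖P (x - v)‖ + ‖P v - z‖ := by
    rw [map_sub]
    exact norm_sub_le_norm_sub_add_norm_sub _ _ _
  have tG : ‖G x - g‖ ≤ ‖G (x - v)‖ + ‖G v - g‖ := by
    rw [map_sub]
    exact norm_sub_le_norm_sub_add_norm_sub _ _ _
  have tH : ‖H x - ζ‖ ≤ ‖H (x - v)‖ + ‖H v - ζ‖ := by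
    rw [map_sub]
    exact norm_sub_le_norm_sub_add_norm_sub _ _ _
  refine ⟨?_, ?_, ?_⟩
  · linarith [hP (x - v)]
  · linarith [hG (x - v)]
  · linarith

/-- **Basic error estimate for the discrete adjoint variable.**  If `y_D` solves the
discrete state equation with discrete control `u_h` and `p_D` solves the discrete adjoint
equation, then the errors in the reconstructed function, gradient and Hessian of `p_D` are
bounded by `2C⁴(‖ū − u_h‖ + W_y + S_y + W_p + S_p)`. -/
theorem discrete_adjoint_error_estimate
    {Ω : Type*} [MeasurableSpace Ω] (μ : Measure Ω) (d : ℕ) (hd : 1 ≤ d)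
    (ω : Set Ω) (hω : MeasurableSet ω)
    {X : Type*} [AddCommGroup X] [Module ℝ X]
    (Pd : X →ₗ[ℝ] Lp ℝ 2 μ)
    (Gd : X →ₗ[ℝ] Lp (EuclideanSpace ℝ (Fin d)) 2 μ)
    (Hd : X →ₗ[ℝ] Lp (EuclideanSpace ℝ (Fin d × Fin d)) 2 μ)
    (C : ℝ) (hC : 1 ≤ C)
    (hcoerPi : ∀ w : X, ‖Pd w‖ ≤ C * ‖Hd w‖)
    (hcoerG : ∀ w : X, ‖Gd w‖ ≤ C * ‖Hd w‖)
    -- the operator 𝒞 (extension by zero) and its adjoint 𝒞* (restriction)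
    (Cop : Lp ℝ 2 (μ.restrict ω) →ₗ[ℝ] Lp ℝ 2 μ)
    (Cs : Lp ℝ 2 μ →ₗ[ℝ] Lp ℝ 2 (μ.restrict ω))
    (hadj : ∀ (q : Lp ℝ 2 μ) (v : Lp ℝ 2 (μ.restrict ω)), ⟪Cs q, v⟫ = ⟪q, Cop v⟫)
    (hiso : ∀ v : Lp ℝ 2 (μ.restrict ω), ‖Cop v‖ = ‖v‖)
    (α : ℝ) (hα : 0 < α) (f yd : Lp ℝ 2 μ) (ud : Lp ℝ 2 (μ.restrict ω))
    (ubar uh : Lp ℝ 2 (μ.restrict ω)) (yD pD : X)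
    (hyD : ∀ w : X, ⟪Hd yD, Hd w⟫ = ⟪f + Cop uh, Pd w⟫)
    (hpD : ∀ w : X, ⟪Hd w, Hd pD⟫ = ⟪Pd yD - yd, Pd w⟫)
    (ybar : Lp ℝ 2 μ) (gy : Lp (EuclideanSpace ℝ (Fin d)) 2 μ)
    (ζy : Lp (EuclideanSpace ℝ (Fin d × Fin d)) 2 μ)
    (Wy : ℝ) (hWy : 0 ≤ Wy)
    (hlcy : ∀ w : X, |⟪f + Cop ubar, Pd w⟫ - ⟪ζy, Hd w⟫| ≤ Wy * ‖Hd w‖)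
    (Sy : ℝ) (hSy : 0 ≤ Sy) (v₀ : X)
    (hconsy : ‖Pd v₀ - ybar‖ + ‖Gd v₀ - gy‖ + ‖Hd v₀ - ζy‖ ≤ Sy)
    (pbar : Lp ℝ 2 μ) (gp : Lp (EuclideanSpace ℝ (Fin d)) 2 μ)
    (ζp : Lp (EuclideanSpace ℝ (Fin d × Fin d)) 2 μ)
    (Wp : ℝ) (hWp : 0 ≤ Wp)
    (hlcp : ∀ w : X, |⟪ybar - yd, Pd w⟫ - ⟪ζp, Hd w⟫| ≤ Wp * ‖Hd w‖)
    (Sp : ℝ) (hSp : 0 ≤ Sp) (v₁ : X)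
    (hconsp : ‖Pd v₁ - pbar‖ + ‖Gd v₁ - gp‖ + ‖Hd v₁ - ζp‖ ≤ Sp) :
    ‖Pd pD - pbar‖ ≤ 2 * C ^ 4 * (‖ubar - uh‖ + Wy + Sy + Wp + Sp) ∧
      ‖Gd pD - gp‖ ≤ 2 * C ^ 4 * (‖ubar - uh‖ + Wy + Sy + Wp + Sp) ∧
      ‖Hd pD - ζp‖ ≤ 2 * C ^ 4 * (‖ubar - uh‖ + Wy + Sy + Wp + Sp) := by
  have hstate := (perturbed_strang_estimate Pd Gd Hd hC hcoerPi hcoerG hWy hyD hlcy hconsy).1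
  have hcontrol : ‖f + Cop uh - (f + Cop ubar)‖ = ‖ubar - uh‖ := by
    rw [add_sub_add_left_eq_sub, ← map_sub, hiso, norm_sub_rev]
  rw [hcontrol] at hstate
  have hadjoint := perturbed_strang_estimate Pd Gd Hd hC hcoerPi hcoerG hWp
    (fun w => (real_inner_comm _ _).trans (hpD w)) hlcp hconsp
  rw [sub_sub_sub_cancel_right] at hadjoint
  set e := ‖ubar - uh‖
  set δ := ‖Pd yD - ybar‖
  have he : 0 ≤ e := norm_nonneg _
  have hC0 : 0 ≤ C := zero_le_one.trans hC
  have h14 : C ≤ C ^ 4 := le_self_pow₀ hC (by norm_num)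
  have h04 : 1 ≤ C ^ 4 := one_le_pow₀ hC
  have h24 : C ^ 2 ≤ C ^ 4 := pow_le_pow_right₀ hC (by norm_num)
  have h34 : C ^ 3 ≤ C ^ 4 := pow_le_pow_right₀ hC (by norm_num)
  have hδ : C * δ ≤ C ^ 3 * e + C ^ 2 * (Wy + Sy) :=
    (mul_le_mul_of_nonneg_left hstate hC0).trans_eq (by ring)
  have hCδ : C * (C * δ) ≤ C ^ 4 * e + C ^ 3 * (Wy + Sy) :=
    (mul_le_mul_of_nonneg_left hδ hC0).trans_eq (by ring)
  have hy := add_nonneg hWy hSy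
  have hp := add_nonneg hWp hSp
  have b1 := mul_le_mul_of_nonneg_right h34 hy
  have b2 := mul_le_mul_of_nonneg_right h14 hp
  have b3 := mul_le_mul_of_nonneg_right h34 he
  have b4 := mul_le_mul_of_nonneg_right h24 hy
  have b5 := mul_le_mul_of_nonneg_right h04 hp
  have c1 : 0 ≤ C ^ 4 * e := by positivity
  have c2 : 0 ≤ C ^ 4 * (Wy + Sy) := by positivity
  have hlarge : C * (C * δ + Wp + Sp) ≤ 2 * C ^ 4 * (e + Wy + Sy + Wp + Sp) := by linarith
  have hHess : C * δ + Wp + 2 * Sp ≤ 2 * C ^ 4 * (e + Wy + Sy + Wp + Sp) := by linarith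
  exact ⟨hadjoint.1.trans hlarge, hadjoint.2.1.trans hlarge, hadjoint.2.2.trans hHess⟩
end

section
/- Let u_h ∈ U_adh. Then u_h satisfies the variational inequality ⟨q + α(u_h − u_d), v − u_h⟩ ≥ 0 for all v ∈ U_adh if and only if, for every i ∈ {1, …, n}, the constant value c_i of u_h on K_i equals P_{[a,b]}( (1/μ(K_i)) ∫_{K_i} (u_d − α⁻¹ q) dμ ). -/
open MeasureTheory
open scoped RealInnerProductSpace

/-- Variational characterization of the projection of `t` onto the interval `[a, b]`. -/
theorem eq_min_max_iff_forall_mul_nonneg {a b c t : ℝ} (hac : a ≤ c) (hcb : c ≤ b) :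
    c = min b (max a t) ↔ ∀ s, a ≤ s → s ≤ b → 0 ≤ (s - c) * (c - t) := by
  constructor
  · intro h s has hsb
    rcases le_total t a with hta | hta
    · rw [max_eq_left hta, min_eq_right (hac.trans hcb)] at h
      subst h
      exact mul_nonneg (by linarith) (by linarith)
    · rw [max_eq_right hta] at h
      rcases le_total t b with htb | htb
      · rw [min_eq_right htb] at h
        simp [h]
      · rw [min_eq_left htb] at h
        subst h
        exact mul_nonneg_of_nonpos_of_nonpos (by linarith) (by linarith)
  · intro h
    have hs := h (min b (max a t)) (le_min (hac.trans hcb) (le_max_left _ _)) (min_le_left _ _)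
    rcases le_total t a with hta | hta
    · rw [max_eq_left hta, min_eq_right (hac.trans hcb)] at hs ⊢
      nlinarith
    · rw [max_eq_right hta] at hs ⊢
      rcases le_total t b with htb | htb
      · rw [min_eq_right htb] at hs ⊢
        nlinarith
      · rw [min_eq_left htb] at hs ⊢
        nlinarith

/-- An `L²` function is integrable on every set of finite measure. -/
theorem integrableOn_of_Lp_two {ω : Type*} [MeasurableSpace ω] {μ : Measure ω}
    (f : Lp ℝ 2 μ) {s : Set ω} (hs : μ s < ⊤) : IntegrableOn f s μ :=
  integrableOn_Lp_of_measure_ne_top f (by norm_num) hs.ne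

/-- The `L²` inner product with a function that is constant on each cell of a partition. -/
theorem inner_eq_sum_mul_setIntegral {ω : Type*} [MeasurableSpace ω] {μ : Measure ω}
    {ι : Type*} [Fintype ι] {K : ι → Set ω} (hKmeas : ∀ i, MeasurableSet (K i))
    (hKdisj : Pairwise (Function.onFun Disjoint K)) (hKcover : (⋃ i, K i) = Set.univ)
    (g w : Lp ℝ 2 μ) (d : ι → ℝ) (hd : ∀ i, ∀ᵐ x ∂(μ.restrict (K i)), w x = d i) :
    ⟪g, w⟫ = ∑ i, d i * ∫ x in K i, g x ∂μ := by
  have hint : Integrable (fun x => ⟪g x, w x⟫) μ := L2.integrable_inner g w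
  rw [L2.inner_def, ← setIntegral_univ, ← hKcover,
    integral_iUnion_fintype hKmeas hKdisj fun i => hint.integrableOn]
  refine Finset.sum_congr rfl fun i _ => ?_
  rw [← integral_const_mul]
  refine integral_congr_ae ?_
  filter_upwards [hd i] with x hx
  simp [hx]

/-- The integral of the reduced gradient over a cell where the control is constant. -/
theorem setIntegral_gradient_eq {ω : Type*} [MeasurableSpace ω] {μ : Measure ω}
    {α : ℝ} (hα : α ≠ 0) (ud q u : Lp ℝ 2 μ) {s : Set ω} (hs0 : 0 < μ s) (hs : μ s < ⊤)
    {c : ℝ} (hc : ∀ᵐ x ∂(μ.restrict s), u x = c) :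
    ∫ x in s, (q + α • (u - ud) : Lp ℝ 2 μ) x ∂μ =
      α * (μ s).toReal *
        (c - (μ s).toReal⁻¹ * ∫ x in s, (ud x - α⁻¹ * q x) ∂μ) := by
  have hm : (μ s).toReal ≠ 0 := (ENNReal.toReal_pos hs0.ne' hs.ne).ne'
  have hq := integrableOn_of_Lp_two q hs
  have hud := integrableOn_of_Lp_two ud hs
  have hdiff : IntegrableOn (fun x => ud x - α⁻¹ * q x) s μ := hud.sub (hq.const_mul _)
  have hconst : IntegrableOn (fun _ => c) s μ := integrableOn_const hs.ne
  have hae : (fun x => (q + α • (u - ud) : Lp ℝ 2 μ) x) =ᵐ[μ.restrict s]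
      fun x => α * (c - (ud x - α⁻¹ * q x)) := by
    filter_upwards [hc, ae_restrict_of_ae (Lp.coeFn_add q (α • (u - ud))),
      ae_restrict_of_ae (Lp.coeFn_smul α (u - ud)),
      ae_restrict_of_ae (Lp.coeFn_sub u ud)] with x h1 h2 h3 h4
    rw [h2, Pi.add_apply, h3, Pi.smul_apply, h4, Pi.sub_apply, h1, smul_eq_mul]
    field_simp
    ring
  rw [integral_congr_ae hae, integral_const_mul,
    integral_sub hconst hdiff, setIntegral_const, smul_eq_mul,
    measureReal_def]
  field_simp

/-- **Pointwise characterization of the discrete optimality condition** for piecewise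
constant controls: `u_h ∈ U_adh` satisfies the variational inequality
`⟨q + α(u_h − u_d), v − u_h⟩ ≥ 0` for all `v ∈ U_adh` if and only if, on each cell `K_i`,
its constant value `c_i` equals `P_{[a,b]}((1/μ(K_i)) ∫_{K_i} (u_d − α⁻¹ q) dμ)`. -/
theorem discrete_optimality_projection_characterization
    {ω : Type*} [MeasurableSpace ω] (μ : Measure ω)
    (α : ℝ) (hα : 0 < α) (ud q : Lp ℝ 2 μ)
    (n : ℕ) (K : Fin n → Set ω)
    (hKmeas : ∀ i, MeasurableSet (K i))
    (hKdisj : Pairwise (Function.onFun Disjoint K))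
    (hKcover : (⋃ i, K i) = Set.univ)
    (hKpos : ∀ i, 0 < μ (K i)) (hKfin : ∀ i, μ (K i) < ⊤)
    (a b : ℝ) (hab : a ≤ b)
    (uh : Lp ℝ 2 μ) (c : Fin n → ℝ)
    -- `u_h ∈ U_h`, with constant value `c i` on `K i`
    (hc : ∀ i, ∀ᵐ x ∂(μ.restrict (K i)), uh x = c i)
    -- `a ≤ u_h ≤ b` a.e., i.e. `u_h ∈ U_adh`
    (hbound : ∀ᵐ x ∂μ, a ≤ uh x ∧ uh x ≤ b) :
    (∀ v : Lp ℝ 2 μ,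
        (∃ cv : Fin n → ℝ, ∀ i, ∀ᵐ x ∂(μ.restrict (K i)), v x = cv i) →
        (∀ᵐ x ∂μ, a ≤ v x ∧ v x ≤ b) →
        0 ≤ ⟪q + α • (uh - ud), v - uh⟫) ↔
      ∀ i, c i =
        min b (max a ((μ (K i)).toReal⁻¹ * ∫ x in K i, (ud x - α⁻¹ * q x) ∂μ)) := by
  have hcb : ∀ (v : Lp ℝ 2 μ) (cv : Fin n → ℝ),
      (∀ i, ∀ᵐ x ∂(μ.restrict (K i)), v x = cv i) → (∀ᵐ x ∂μ, a ≤ v x ∧ v x ≤ b) →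
      ∀ i, a ≤ cv i ∧ cv i ≤ b := by
    intro v cv hv hvb i
    have : (ae (μ.restrict (K i))).NeBot := by
      rw [ae_restrict_neBot]
      exact (hKpos i).ne'
    obtain ⟨x, hx, hxb⟩ := ((hv i).and (ae_restrict_of_ae hvb)).exists
    rwa [hx] at hxb
  have hsub : ∀ (v : Lp ℝ 2 μ) (cv : Fin n → ℝ),
      (∀ i, ∀ᵐ x ∂(μ.restrict (K i)), v x = cv i) →
      ∀ i, ∀ᵐ x ∂(μ.restrict (K i)), (v - uh : Lp ℝ 2 μ) x = cv i - c i := by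
    intro v cv hv i
    filter_upwards [hv i, hc i, ae_restrict_of_ae (Lp.coeFn_sub v uh)] with x h1 h2 h3
    rw [h3, Pi.sub_apply, h1, h2]
  have hcoef : ∀ i, 0 < α * (μ (K i)).toReal := fun i =>
    mul_pos hα (ENNReal.toReal_pos (hKpos i).ne' (hKfin i).ne)
  have hgrad := fun i => setIntegral_gradient_eq hα.ne' ud q uh (hKpos i) (hKfin i) (hc i)
  have hc_mem := hcb uh c hc hbound
  constructor
  · intro h i
    refine (eq_min_max_iff_forall_mul_nonneg (hc_mem i).1 (hc_mem i).2).2 fun s has hsb => ?_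
    set e : Lp ℝ 2 μ := indicatorConstLp 2 (hKmeas i) (hKfin i).ne (s - c i) with he
    have he_in : ∀ᵐ x ∂μ, x ∈ K i → e x = s - c i := indicatorConstLp_coeFn_mem
    have he_out : ∀ᵐ x ∂μ, x ∉ K i → e x = 0 := indicatorConstLp_coeFn_notMem
    have hadd := Lp.coeFn_add uh e
    have huh : ∀ᵐ x ∂μ, x ∈ K i → uh x = c i := (ae_restrict_iff' (hKmeas i)).1 (hc i)
    have hv : ∀ j, ∀ᵐ x ∂(μ.restrict (K j)),
        (uh + e : Lp ℝ 2 μ) x = Function.update c i s j := by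
      intro j
      filter_upwards [hc j, ae_restrict_mem (hKmeas j), ae_restrict_of_ae he_in,
        ae_restrict_of_ae he_out, ae_restrict_of_ae hadd] with x h1 hx h2 h3 h4
      rw [h4, Pi.add_apply, h1]
      by_cases hj : j = i
      · subst hj
        rw [h2 hx, Function.update_self]
        ring
      · rw [h3 (Set.disjoint_left.1 (hKdisj hj) hx), Function.update_of_ne hj, add_zero]
    have hvi := h (uh + e) ⟨_, hv⟩ (by
      filter_upwards [hbound, huh, he_in, he_out, hadd] with x h1 h2 h3 h4 h5
      rw [h5, Pi.add_apply]
      by_cases hx : x ∈ K i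
      · rw [h2 hx, h3 hx, add_sub_cancel]
        exact ⟨has, hsb⟩
      · rwa [h4 hx, add_zero])
    rw [inner_eq_sum_mul_setIntegral hKmeas hKdisj hKcover _ _ _ (hsub _ _ hv),
      Finset.sum_eq_single i (fun j _ hj => by simp [Function.update_of_ne hj]) (by simp),
      Function.update_self, hgrad i, mul_left_comm] at hvi
    exact nonneg_of_mul_nonneg_right hvi (hcoef i)
  · rintro h v ⟨cv, hv⟩ hvb
    rw [inner_eq_sum_mul_setIntegral hKmeas hKdisj hKcover _ _ _ (hsub v cv hv)]
    refine Finset.sum_nonneg fun i _ => ?_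
    rw [hgrad i, mul_left_comm]
    have hcv := hcb v cv hv hvb i
    exact mul_nonneg (hcoef i).le
      ((eq_min_max_iff_forall_mul_nonneg (hc_mem i).1 (hc_mem i).2).1 (h i) _ hcv.1 hcv.2)
end
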